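/- arXiv:2603.07152 — 7 statements merged into one kernel-verified Lean document; each statement's English description precedes it below -/
import Mathlib

section
/- Assume γ = D_d − p ≥ 0. Then the following two multisets of integers are equal: the multiset {{ j − sht(j) : 1 ≤ j ≤ p−1 }} ⊎ {{ 0, −1, −2, …, −γ }}, and the multiset {{ θ(y) + i : y ∈ F with reduced denominator r, 0 ≤ i ≤ N_r − 1 }}. -/
/-- `sht(j) = ∑_{(λ,i)∈I*} ⌊ij/p⌋` where `I* = {(λ,i) : 1 ≤ i ≤ d λ}`. -/
noncomputable def sht (p l : ℕ) (d : Fin l → ℕ) (j : ℕ) : ℤ :=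
  ∑ lam : Fin l, ∑ i ∈ Finset.Icc 1 (d lam), ⌊(i * j : ℚ) / p⌋

/-- `θ(y) = 1 − ⌊y⌋ + ⌊py⌋ − ∑_{(λ,i)∈I*} ⌊iy⌋`. -/
noncomputable def theta (p l : ℕ) (d : Fin l → ℕ) (y : ℚ) : ℤ :=
  1 - ⌊y⌋ + ⌊(p : ℚ) * y⌋ - ∑ lam : Fin l, ∑ i ∈ Finset.Icc 1 (d lam), ⌊(i : ℚ) * y⌋

/-- `N_r = #{(λ,i) ∈ I* : r ∣ i}`. -/
def Nr (l : ℕ) (d : Fin l → ℕ) (r : ℕ) : ℕ :=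
  ∑ lam : Fin l, ((Finset.Icc 1 (d lam)).filter (fun i => r ∣ i)).card

/-- `D_d = ∑_λ d_λ(d_λ+1)/2`. -/
def Dd (l : ℕ) (d : Fin l → ℕ) : ℕ :=
  ∑ lam : Fin l, d lam * (d lam + 1) / 2

/-- The Farey set of order `M`: the rationals `s/r` with `1 ≤ s ≤ r ≤ M`,
i.e. `(⋃_{j=1}^M (1/j)ℤ) ∩ (0,1]`, as a finite set. -/
def fareyFinset (M : ℕ) : Finset ℚ :=
  (Finset.Icc 1 M).biUnion (fun r => (Finset.Icc 1 r).image (fun s : ℕ => (s : ℚ) / (r : ℚ)))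

def SS (r : ℕ) : Finset ℚ := (Finset.Icc 1 r).image (fun s : ℕ => (s : ℚ) / (r : ℚ))

lemma den_dvd_iff (y : ℚ) (Q : ℕ) (hQ : 0 < Q) : y.den ∣ Q ↔ ∃ n : ℤ, y * Q = n := by
  have hQ' : (Q : ℚ) ≠ 0 := by positivity
  constructor
  · rintro ⟨c, rfl⟩
    refine ⟨y.num * c, ?_⟩
    push_cast
    rw [← mul_assoc, Rat.mul_den_eq_num]
  · rintro ⟨n, hn⟩
    have h : y = (n : ℚ) / ((Q : ℤ) : ℚ) := by
      rw [eq_div_iff (by exact_mod_cast hQ')]; exact_mod_cast hn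
    have := Rat.den_dvd n (Q : ℤ)
    rw [Rat.divInt_eq_div, ← h] at this
    exact_mod_cast this

lemma mem_SS (y : ℚ) (Q : ℕ) (hQ : 0 < Q) : y ∈ SS Q ↔ 0 < y ∧ y ≤ 1 ∧ y.den ∣ Q := by
  have hQ' : (0 : ℚ) < Q := by positivity
  rw [den_dvd_iff y Q hQ]
  simp only [SS, Finset.mem_image, Finset.mem_Icc]
  constructor
  · rintro ⟨s, ⟨h1, h2⟩, rfl⟩
    refine ⟨by positivity, ?_, s, ?_⟩
    · rw [div_le_one hQ']; exact_mod_cast h2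
    · field_simp; simp
  · rintro ⟨h0, h1, n, hn⟩
    have hn0 : (0 : ℚ) < n := by rw [← hn]; positivity
    have hn0' : 0 < n := by exact_mod_cast hn0
    have hn1 : (n : ℚ) ≤ Q := by rw [← hn]; nlinarith
    have hn1' : n ≤ Q := by exact_mod_cast hn1
    lift n to ℕ using hn0'.le
    refine ⟨n, ⟨by omega, by omega⟩, ?_⟩
    rw [div_eq_iff hQ'.ne']; exact_mod_cast hn.symm

lemma mem_farey (y : ℚ) (M : ℕ) : y ∈ fareyFinset M ↔ 0 < y ∧ y ≤ 1 ∧ y.den ≤ M := by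
  have : y ∈ fareyFinset M ↔ ∃ r, (1 ≤ r ∧ r ≤ M) ∧ y ∈ SS r := by
    simp only [fareyFinset, Finset.mem_biUnion, Finset.mem_Icc, SS]
  rw [this]
  constructor
  · rintro ⟨r, ⟨h1, h2⟩, h3⟩
    rw [mem_SS y r h1] at h3
    exact ⟨h3.1, h3.2.1, (Nat.le_of_dvd h1 h3.2.2).trans h2⟩
  · rintro ⟨h1, h2, h3⟩
    exact ⟨y.den, ⟨y.den_pos, h3⟩, (mem_SS _ _ y.den_pos).2 ⟨h1, h2, dvd_rfl⟩⟩

lemma floor_step (Q i k : ℕ) (hQ : 0 < Q) (hi : i ∣ Q) :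
    ⌊(i : ℚ) * (((k + 1 : ℕ) : ℚ) / Q)⌋ = ⌊(i : ℚ) * ((k : ℚ) / Q)⌋
      + if (((k + 1 : ℕ) : ℚ) / Q).den ∣ i then 1 else 0 := by
  obtain ⟨m, rfl⟩ := hi
  have hi : 0 < i := by rcases Nat.eq_zero_or_pos i with h | h <;> simp_all
  have hm : 0 < m := by rcases Nat.eq_zero_or_pos m with h | h <;> simp_all
  have hi' : (i : ℚ) ≠ 0 := by positivity
  have hm' : (m : ℚ) ≠ 0 := by positivity
  have key : ∀ a : ℕ, (i : ℚ) * ((a : ℚ) / ((i * m : ℕ) : ℚ)) = (a : ℚ) / (m : ℚ) := by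
    intro a; push_cast; field_simp
  rw [key, key, Rat.floor_natCast_div_natCast, Rat.floor_natCast_div_natCast, ← Int.natCast_div, ← Int.natCast_div, Nat.succ_div]
  have e : (((k + 1 : ℕ) : ℚ) / ((i * m : ℕ) : ℚ)).den ∣ i ↔ m ∣ k + 1 := by
    rw [den_dvd_iff _ _ hi, mul_comm, key]
    constructor
    · rintro ⟨n, hn⟩
      rw [div_eq_iff hm'] at hn
      have : ((k + 1 : ℕ) : ℤ) = n * m := by exact_mod_cast hn
      exact Int.natCast_dvd_natCast.1 ⟨n, by rw [this, mul_comm]⟩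
    · rintro ⟨c, hc⟩
      refine ⟨c, ?_⟩
      rw [hc]; push_cast; field_simp
  simp only [e]
  push_cast
  rfl

lemma Nr_zero (l : ℕ) (d : Fin l → ℕ) (r : ℕ) (h : ∀ lam, d lam < r) : Nr l d r = 0 := by
  unfold Nr
  refine Finset.sum_eq_zero fun lam _ => ?_
  rw [Finset.card_eq_zero, Finset.filter_eq_empty_iff]
  intro i hi hr
  rw [Finset.mem_Icc] at hi
  have := Nat.le_of_dvd (by omega) hr
  have := h lam
  omega

lemma theta_step (p l : ℕ) (hp : p.Prime) (d : Fin l → ℕ) (Q k : ℕ) (hQ : 0 < Q) (hpQ : p ∣ Q)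
    (hdQ : ∀ lam, ∀ i ∈ Finset.Icc 1 (d lam), i ∣ Q) :
    theta p l d (((k + 1 : ℕ) : ℚ) / Q) = theta p l d ((k : ℚ) / Q)
      + (if (((k + 1 : ℕ) : ℚ) / Q).den = p then 1 else 0)
      - Nr l d (((k + 1 : ℕ) : ℚ) / Q).den := by
  have h1 := floor_step Q 1 k hQ (one_dvd _)
  have h2 := floor_step Q p k hQ hpQ
  have h3 : ∑ lam : Fin l, ∑ i ∈ Finset.Icc 1 (d lam), ⌊(i : ℚ) * (((k + 1 : ℕ) : ℚ) / Q)⌋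
     = ∑ lam : Fin l, ∑ i ∈ Finset.Icc 1 (d lam), ⌊(i : ℚ) * ((k : ℚ) / Q)⌋
      + Nr l d (((k + 1 : ℕ) : ℚ) / Q).den := by
    unfold Nr
    push_cast [Finset.card_filter]
    rw [← Finset.sum_add_distrib]
    refine Finset.sum_congr rfl fun lam _ => ?_
    rw [← Finset.sum_add_distrib]
    refine Finset.sum_congr rfl fun i hi => ?_
    have := floor_step Q i k hQ (hdQ lam i hi)
    push_cast at this
    exact this
  unfold theta
  rw [h3, h2]
  simp only [Nat.cast_one, one_mul] at h1
  rw [h1]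
  generalize (((k + 1 : ℕ) : ℚ) / Q).den = r
  have := hp.one_lt
  simp only [Nat.dvd_one, Nat.dvd_prime hp]
  split_ifs <;> first | omega | (simp_all; done) | (simp_all; omega)

lemma theta_one (p l : ℕ) (d : Fin l → ℕ) : theta p l d 1 = p - Dd l d := by
  unfold theta Dd
  simp only [Int.floor_one, mul_one, Int.floor_natCast]
  push_cast
  have : ∀ n : ℕ, ∑ i ∈ Finset.Icc 1 n, (i : ℤ) = (n : ℤ) * (n + 1) / 2 := by
    intro n
    have h : (∑ i ∈ Finset.Icc 1 n, i) = n * (n + 1) / 2 := by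
      have h2 := Finset.sum_range_id (n + 1)
      rw [Finset.sum_range_succ'] at h2
      rw [Finset.range_eq_Ico, Finset.sum_Ico_add' (fun i => i) 0 n 1] at h2
      rw [mul_comm]
      have r : Finset.Icc 1 n = Finset.Ico (0 + 1) (n + 1) := by
        ext; simp only [Finset.mem_Icc, Finset.mem_Ico]; omega
      rw [r]
      simpa using h2
    have h' := congrArg (Nat.cast : ℕ → ℤ) h
    push_cast at h'
    exact h'
  simp [this]

lemma theta_zero (p l : ℕ) (d : Fin l → ℕ) : theta p l d 0 = 1 := by
  simp [theta]

lemma theta_frac (p l : ℕ) (hp : p.Prime) (d : Fin l → ℕ) (j : ℕ) (hj : j < p) :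
    theta p l d ((j : ℚ) / p) = 1 + (j - sht p l d j) := by
  have hp' : (0 : ℚ) < p := by exact_mod_cast hp.pos
  have h0 : ⌊(j : ℚ) / p⌋ = 0 := by
    rw [Rat.floor_natCast_div_natCast, ← Int.natCast_div, Nat.div_eq_of_lt hj]; rfl
  unfold theta sht
  rw [h0, mul_div_cancel₀ _ hp'.ne', Int.floor_natCast]
  simp only [mul_div_assoc]
  ring

theorem count_down (v t : ℤ) (n : ℕ) :
    (((Multiset.range n).map (fun i : ℕ => t + (i : ℤ))).count v : ℤ)
      = (if v ≤ t - 1 + n then 1 else 0) - (if v ≤ t - 1 then 1 else 0) := by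
  induction n with
  | zero => simp
  | succ n ih =>
    rw [Multiset.range_succ, Multiset.map_cons, Multiset.count_cons]
    push_cast
    rw [ih]
    split_ifs <;> omega

theorem count_neg' (v : ℤ) (n : ℕ) :
    (((Multiset.range n).map (fun i : ℕ => -(i : ℤ))).count v : ℤ)
      = (if v ≤ 0 then 1 else 0) - (if v ≤ -(n : ℤ) then 1 else 0) := by
  induction n with
  | zero => simp
  | succ n ih =>
    rw [Multiset.range_succ, Multiset.map_cons, Multiset.count_cons]
    push_cast
    rw [ih]
    split_ifs <;> omega

/-- Rösler's multiset equality (Conjecture 5.2 of Tonini–Yasuda, proved in the appendix):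
assuming `γ = D_d − p ≥ 0`,
`{{ j − sht(j) : 1 ≤ j ≤ p−1 }} ⊎ {{ 0, −1, …, −γ }}`
equals `{{ θ(y) + i : y ∈ F, 0 ≤ i ≤ N_{r_y} − 1 }}`,
where `r_y` is the reduced denominator of `y` and `F` is the Farey set of order `max d`. -/
theorem multiset_equality (p l : ℕ) (hp : p.Prime) (d : Fin l → ℕ)
    (hd : ∀ lam, d lam ≤ p - 1) (hγ : p ≤ Dd l d) :
    ((Finset.Icc 1 (p - 1)).val.map (fun j : ℕ => (j : ℤ) - sht p l d j))
      + ((Multiset.range (Dd l d - p + 1)).map (fun i => -(i : ℤ)))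
    = ∑ y ∈ fareyFinset (Finset.univ.sup d),
        (Multiset.range (Nr l d y.den)).map (fun i => theta p l d y + (i : ℤ)) := by
  have hp1 := hp.one_lt
  have hp' : (0 : ℚ) < p := by exact_mod_cast hp.pos
  refine Multiset.ext.2 fun v => ?_
  rw [Multiset.count_add, Multiset.count_sum', ← Nat.cast_inj (R := ℤ), Nat.cast_add, Nat.cast_sum]
  simp only [Multiset.bind_def, Multiset.pure_def, Multiset.bind_singleton, Multiset.map_map, Function.comp_def]
  simp only [count_down, count_neg']
  set M := Finset.univ.sup d with hM
  have hdM : ∀ lam, d lam ≤ M := fun lam => Finset.le_sup (Finset.mem_univ lam)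
  set Q := p * M.factorial with hQd
  have hQ : 0 < Q := Nat.mul_pos hp.pos M.factorial_pos
  have hpQ : p ∣ Q := dvd_mul_right _ _
  have hdQ : ∀ lam, ∀ i ∈ Finset.Icc 1 (d lam), i ∣ Q := by
    intro lam i hi
    rw [Finset.mem_Icc] at hi
    exact dvd_mul_of_dvd_right (Nat.dvd_factorial (by omega) (hi.2.trans (hdM lam))) _
  -- Farey sum
  have hF : ∑ y ∈ fareyFinset M, ((if v ≤ theta p l d y - 1 + (Nr l d y.den : ℤ) then (1 : ℤ) else 0)
        - (if v ≤ theta p l d y - 1 then 1 else 0))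
      = ∑ y ∈ SS Q, ((if v ≤ theta p l d y - 1 + (Nr l d y.den : ℤ) then (1 : ℤ) else 0)
        - (if v ≤ theta p l d y - 1 then 1 else 0)) := by
    apply Finset.sum_subset
    · intro y hy
      rw [mem_farey] at hy
      rw [mem_SS y Q hQ]
      exact ⟨hy.1, hy.2.1, dvd_mul_of_dvd_right (Nat.dvd_factorial y.den_pos hy.2.2) _⟩
    · intro y hy hy'
      rw [mem_SS y Q hQ] at hy
      rw [mem_farey] at hy'
      have h : M < y.den := by
        by_contra hc
        exact hy' ⟨hy.1, hy.2.1, by omega⟩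
      rw [Nr_zero l d y.den (fun lam => (hdM lam).trans_lt h)]
      simp
  -- up steps
  have hU : ((((Finset.Icc 1 (p - 1)).val.map (fun j : ℕ => (j : ℤ) - sht p l d j)).count v : ℕ) : ℤ)
      = ∑ y ∈ SS Q, if y.den = p then (if theta p l d y - 1 = v then (1 : ℤ) else 0) else 0 := by
    rw [← Finset.sum_filter]
    have e : (SS Q).filter (fun y => y.den = p)
        = (Finset.Icc 1 (p - 1)).image (fun j : ℕ => (j : ℚ) / p) := by
      ext y
      rw [Finset.mem_filter, mem_SS y Q hQ]
      constructor
      · rintro ⟨⟨h0, h1, h2⟩, h3⟩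
        have := (mem_SS y p hp.pos).2 ⟨h0, h1, h3.dvd⟩
        simp only [SS, Finset.mem_image, Finset.mem_Icc] at this ⊢
        obtain ⟨s, hs, rfl⟩ := this
        refine ⟨s, ⟨hs.1, ?_⟩, rfl⟩
        rcases Nat.lt_or_ge s p with h | h
        · omega
        · exfalso
          have : s = p := by omega
          rw [this, div_self hp'.ne'] at h3
          simp at h3
          omega
      · intro h
        have hS : y ∈ SS p := by
          simp only [SS, Finset.mem_image, Finset.mem_Icc] at h ⊢
          obtain ⟨s, hs, rfl⟩ := h
          exact ⟨s, ⟨hs.1, by omega⟩, rfl⟩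
        rw [mem_SS y p hp.pos] at hS
        refine ⟨⟨hS.1, hS.2.1, hS.2.2.trans hpQ⟩, ?_⟩
        rcases (Nat.dvd_prime hp).1 hS.2.2 with h1 | h1
        · exfalso
          simp only [Finset.mem_image, Finset.mem_Icc] at h
          obtain ⟨s, hs, rfl⟩ := h
          obtain ⟨n, hn⟩ := (den_dvd_iff _ 1 one_pos).1 h1.dvd
          have hn0 : (0 : ℚ) < n := by rw [← hn]; simpa using hS.1
          have hn1 : (n : ℚ) < 1 := by
            rw [← hn, Nat.cast_one, mul_one, div_lt_one hp']
            exact_mod_cast (by omega : s < p)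
          have a : 0 < n := by exact_mod_cast hn0
          have b : n < 1 := by exact_mod_cast hn1
          omega
        · exact h1
    rw [e, Finset.sum_image]
    · rw [Multiset.count_map, ← Finset.filter_val, Finset.card_val, Finset.card_filter]
      push_cast
      refine Finset.sum_congr rfl fun j hj => ?_
      rw [Finset.mem_Icc] at hj
      rw [theta_frac p l hp d j (by omega)]
      congr 1
      apply propext
      constructor <;> intro h <;> omega
    · intro a _ b _ hab
      have := (div_left_inj' hp'.ne').1 hab
      exact_mod_cast this
  rw [hF, hU]
  -- telescoping
  have tele : ∑ y ∈ SS Q, (((if v ≤ theta p l d y - 1 + (Nr l d y.den : ℤ) then (1 : ℤ) else 0)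
        - (if v ≤ theta p l d y - 1 then 1 else 0))
        - (if y.den = p then (if theta p l d y - 1 = v then (1 : ℤ) else 0) else 0))
      = (if v ≤ 0 then 1 else 0) - (if v ≤ theta p l d 1 - 1 then 1 else 0) := by
    have hQ' : (Q : ℚ) ≠ 0 := by positivity
    unfold SS
    rw [Finset.sum_image]
    · have h := Finset.sum_range_sub' (fun k : ℕ =>
        if v ≤ theta p l d ((k : ℚ) / Q) - 1 then (1 : ℤ) else 0) Q
      rw [div_self hQ', Nat.cast_zero, zero_div, theta_zero, sub_self] at h
      rw [← h]
      have r : Finset.Icc 1 Q = Finset.Ico (0 + 1) (Q + 1) := by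
        ext; simp only [Finset.mem_Icc, Finset.mem_Ico]; omega
      rw [r, ← Finset.sum_Ico_add' _ 0 Q 1, Finset.range_eq_Ico]
      refine Finset.sum_congr rfl fun k _ => ?_
      have st := theta_step p l hp d Q k hQ hpQ hdQ
      have hz : (((k + 1 : ℕ) : ℚ) / Q).den = p → Nr l d (((k + 1 : ℕ) : ℚ) / Q).den = 0 := by
        intro h
        rw [h]
        exact Nr_zero l d p (fun lam => by have := hd lam; omega)
      generalize (((k + 1 : ℕ) : ℚ) / Q) = y at *
      by_cases hy : y.den = p
      · have := hz hy
        rw [if_pos hy] at st ⊢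
        rw [this] at st ⊢
        split_ifs <;> omega
      · rw [if_neg hy] at st ⊢
        split_ifs <;> omega
    · intro a _ b _ hab
      have := (div_left_inj' hQ').1 hab
      exact_mod_cast this
  rw [Finset.sum_sub_distrib, theta_one] at tele
  have hc : (-((Dd l d - p + 1 : ℕ) : ℤ)) = (p : ℤ) - Dd l d - 1 := by omega
  rw [hc]
  linarith
end

section
/- Let j be an integer with 1 ≤ j ≤ p−2. If F ∩ (j/p, (j+1)/p) = ∅, then sht(j) = sht(j+1). -/
/-- The Farey set of order `M`: `F = (⋃_{j=1}^M (1/j)ℤ) ∩ (0,1]`. -/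
def fareySet (M : ℕ) : Set ℚ :=
  {y | (∃ j : ℕ, 1 ≤ j ∧ j ≤ M ∧ ∃ k : ℤ, y = (k : ℚ) / (j : ℚ)) ∧ 0 < y ∧ y ≤ 1}

/-- If the Farey set of order `M = max d` misses the open interval `(j/p, (j+1)/p)`,
then `sht(j) = sht(j+1)` (for `1 ≤ j ≤ p−2`). -/
theorem sht_constant (p l : ℕ) (hp : p.Prime) (d : Fin l → ℕ)
    (hd : ∀ lam, d lam ≤ p - 1) (j : ℕ) (hj1 : 1 ≤ j) (hj2 : j ≤ p - 2)
    (hF : fareySet (Finset.univ.sup d) ∩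
      Set.Ioo ((j : ℚ) / p) (((j : ℚ) + 1) / p) = ∅) :
    sht p l d j = sht p l d (j + 1) := by
  have hp2 := hp.two_le
  have hpQ : (0 : ℚ) < p := by exact_mod_cast hp.pos
  unfold sht
  refine Finset.sum_congr rfl fun lam _ => Finset.sum_congr rfl fun i hi => ?_
  rw [Finset.mem_Icc] at hi
  obtain ⟨hi1, hi2⟩ := hi
  have hdl := hd lam
  have hsup : d lam ≤ Finset.univ.sup d := Finset.le_sup (Finset.mem_univ lam)
  have hiQ : (0 : ℚ) < i := by exact_mod_cast hi1
  have hjQ : (0 : ℚ) < j := by exact_mod_cast hj1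
  have hjp : (j : ℚ) + 1 ≤ p := by
    have : j + 1 ≤ p := by omega
    exact_mod_cast this
  apply le_antisymm
  · apply Int.floor_le_floor
    push_cast
    gcongr
    linarith
  · by_contra hlt
    push Not at hlt
    set k : ℤ := ⌊((i : ℚ) * ((j + 1 : ℕ) : ℚ)) / p⌋ with hk
    have h1 : ((i : ℚ) * j) / p < k := Int.floor_lt.mp hlt
    have h2 : (k : ℚ) ≤ ((i : ℚ) * ((j + 1 : ℕ) : ℚ)) / p := Int.floor_le _
    rw [div_lt_iff₀ hpQ] at h1
    rw [le_div_iff₀ hpQ] at h2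
    have hne : (k : ℚ) * p ≠ (i : ℚ) * ((j + 1 : ℕ) : ℚ) := by
      intro h
      have h' : k * (p : ℤ) = (i : ℤ) * ((j + 1 : ℕ) : ℤ) := by exact_mod_cast h
      have hdv : (p : ℤ) ∣ ((i * (j + 1) : ℕ) : ℤ) := ⟨k, by push_cast at h' ⊢; linarith⟩
      rw [Int.natCast_dvd_natCast] at hdv
      rcases hp.dvd_mul.mp hdv with h | h
      · have := Nat.le_of_dvd hi1 h
        omega
      · have := Nat.le_of_dvd (Nat.succ_pos j) h
        omega
    have h3 := lt_of_le_of_ne h2 hne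
    push_cast at h3
    have hlo : (j : ℚ) / p < (k : ℚ) / i := by
      rw [div_lt_div_iff₀ hpQ hiQ]; linarith
    have hhi : (k : ℚ) / i < ((j : ℚ) + 1) / p := by
      rw [div_lt_div_iff₀ hiQ hpQ]; linarith
    have hmem : (k : ℚ) / i ∈ fareySet (Finset.univ.sup d) ∩
        Set.Ioo ((j : ℚ) / p) (((j : ℚ) + 1) / p) := by
      refine ⟨⟨⟨i, hi1, by omega, k, rfl⟩, lt_trans (by positivity) hlo, ?_⟩, hlo, hhi⟩
      exact hhi.le.trans ((div_le_one hpQ).mpr hjp)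
    rw [hF] at hmem
    exact hmem
end

section
/- Let j be an integer with 1 ≤ j ≤ p−1. If F ∩ (j/p, (j+1)/p) ≠ ∅, then sht(j+1) ≥ sht(j) + 1; equivalently, j − sht(j) ≥ (j+1) − sht(j+1). -/
/-- If the Farey set of order `M = max d` meets the open interval `(j/p, (j+1)/p)`,
then `sht(j+1) ≥ sht(j) + 1`, i.e. `j − sht(j) ≥ (j+1) − sht(j+1)` (for `1 ≤ j ≤ p−1`). -/
theorem sht_increases (p l : ℕ) (hp : p.Prime) (d : Fin l → ℕ)
    (hd : ∀ lam, d lam ≤ p - 1) (j : ℕ) (hj1 : 1 ≤ j) (hj2 : j ≤ p - 1)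
    (hF : (fareySet (Finset.univ.sup d) ∩
      Set.Ioo ((j : ℚ) / p) (((j : ℚ) + 1) / p)).Nonempty) :
    sht p l d (j + 1) ≥ sht p l d j + 1 := by
  obtain ⟨y, ⟨⟨r, hr1, hrM, k, hy⟩, _, _⟩, hlo, hhi⟩ := hF
  have hp0 : (0 : ℚ) < p := by exact_mod_cast hp.pos
  have hr0 : (0 : ℚ) < r := by exact_mod_cast hr1
  obtain ⟨lam, _, hlam⟩ := (Finset.le_sup_iff (show (⊥ : ℕ) < r from hr1)).1 hrM
  have hmono : ∀ i : ℕ, ⌊((i : ℚ) * (j : ℕ)) / p⌋ ≤ ⌊((i : ℚ) * ((j + 1 : ℕ) : ℚ)) / p⌋ := by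
    intro i
    apply Int.floor_le_floor
    push_cast
    gcongr
    linarith
  have hstrict : ⌊((r : ℚ) * (j : ℕ)) / p⌋ < ⌊((r : ℚ) * ((j + 1 : ℕ) : ℚ)) / p⌋ := by
    have hk : (k : ℚ) = r * y := by rw [hy]; field_simp
    have h1 : ⌊((r : ℚ) * (j : ℕ)) / p⌋ < k := by
      rw [Int.floor_lt, hk, mul_div_assoc]
      exact mul_lt_mul_of_pos_left hlo hr0
    have h2 : k ≤ ⌊((r : ℚ) * ((j + 1 : ℕ) : ℚ)) / p⌋ := by
      rw [Int.le_floor, hk, mul_div_assoc]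
      push_cast
      exact (mul_lt_mul_of_pos_left hhi hr0).le
    exact lt_of_lt_of_le h1 h2
  have key : sht p l d j < sht p l d (j + 1) := by
    unfold sht
    apply Finset.sum_lt_sum
    · intro m _
      exact Finset.sum_le_sum fun i _ => hmono i
    · exact ⟨lam, Finset.mem_univ _, Finset.sum_lt_sum (fun i _ => hmono i)
        ⟨r, Finset.mem_Icc.2 ⟨hr1, hlam⟩, hstrict⟩⟩
  omega
end

section
/- Let y ∈ F with reduced denominator r, and let z be a rational number with 0 < z < y such that F ∩ (z, y) = ∅. Then ∑_{(λ,i)∈I*} ⌊iz⌋ = ∑_{(λ,i)∈I*} ⌊iy⌋ − N_r. -/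
/-- Jump of the counting function `t(y) = ∑_{(λ,i)∈I*} ⌊iy⌋` at a Farey point:
if `y ∈ F` has reduced denominator `r` and `0 < z < y` with `F ∩ (z, y) = ∅`,
then `∑_{(λ,i)} ⌊iz⌋ = ∑_{(λ,i)} ⌊iy⌋ − N_r`. -/
theorem floor_sum_jump (l : ℕ) (d : Fin l → ℕ) (y z : ℚ)
    (hy : y ∈ fareySet (Finset.univ.sup d))
    (hz0 : 0 < z) (hzy : z < y)
    (hF : fareySet (Finset.univ.sup d) ∩ Set.Ioo z y = ∅) :
    (∑ lam : Fin l, ∑ i ∈ Finset.Icc 1 (d lam), ⌊(i : ℚ) * z⌋)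
      = (∑ lam : Fin l, ∑ i ∈ Finset.Icc 1 (d lam), ⌊(i : ℚ) * y⌋)
          - (Nr l d y.den : ℤ) := by
  have key : ∀ i : ℕ, 1 ≤ i → i ≤ Finset.univ.sup d → ∀ K : ℤ, (K : ℚ) < i * y →
      (K : ℚ) ≤ i * z := by
    intro i h1 hM K hK
    by_contra hc
    push Not at hc
    have hi : (0 : ℚ) < i := by exact_mod_cast h1
    have hlt : (K : ℚ) / i < y := by
      rw [div_lt_iff₀ hi]; linarith
    have hgt : z < (K : ℚ) / i := by
      rw [lt_div_iff₀ hi]; linarith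
    have hmem : (K : ℚ) / i ∈ fareySet (Finset.univ.sup d) ∩ Set.Ioo z y :=
      ⟨⟨⟨i, h1, hM, K, rfl⟩, hz0.trans hgt, hlt.le.trans hy.2.2⟩, hgt, hlt⟩
    rw [hF] at hmem
    exact hmem
  have main : ∀ i : ℕ, 1 ≤ i → i ≤ Finset.univ.sup d →
      ⌊(i : ℚ) * z⌋ = ⌊(i : ℚ) * y⌋ - (if y.den ∣ i then (1 : ℤ) else 0) := by
    intro i h1 hM
    have hi : (0 : ℚ) < i := by exact_mod_cast h1
    have hlt : (i : ℚ) * z < i * y := by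
      exact mul_lt_mul_of_pos_left hzy hi
    split_ifs with hd
    · obtain ⟨c, rfl⟩ := hd
      have hm : ((y.den * c : ℕ) : ℚ) * y = ((c * y.num : ℤ) : ℚ) := by
        have := Rat.mul_den_eq_num y
        push_cast
        rw [← this]; ring
      rw [hm, Int.floor_intCast, Int.floor_eq_iff]
      refine ⟨key _ h1 hM _ ?_, ?_⟩
      · rw [hm]; push_cast; linarith
      · rw [hm] at hlt; push_cast at hlt ⊢; linarith
    · rw [sub_zero, Int.floor_eq_iff]
      refine ⟨key _ h1 hM _ ?_, hlt.trans (Int.lt_floor_add_one _)⟩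
      refine lt_of_le_of_ne (Int.floor_le _) fun he => hd ?_
      have hy' : y = Rat.divInt ⌊(i : ℚ) * y⌋ (i : ℤ) := by
        rw [Rat.divInt_eq_div, he]
        push_cast
        field_simp
      have h := Rat.den_dvd ⌊(i : ℚ) * y⌋ (i : ℤ)
      rw [← hy'] at h
      exact_mod_cast h
  have hN : (Nr l d y.den : ℤ) = ∑ lam : Fin l, ∑ i ∈ Finset.Icc 1 (d lam),
      (if y.den ∣ i then (1 : ℤ) else 0) := by
    simp [Nr, Finset.sum_boole]
  rw [hN, ← Finset.sum_sub_distrib]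
  refine Finset.sum_congr rfl fun lam _ => ?_
  rw [← Finset.sum_sub_distrib]
  refine Finset.sum_congr rfl fun i hi => ?_
  rw [Finset.mem_Icc] at hi
  exact main i hi.1 (hi.2.trans (Finset.le_sup (f := d) (Finset.mem_univ lam)))
end

section
/- Let j be an integer with 1 ≤ j ≤ p−1 and suppose that F_j := F ∩ (j/p, (j+1)/p) is nonempty. Then the multiset {{ θ(y) + i : y ∈ F_j with reduced denominator r_y, 0 ≤ i ≤ N_{r_y} − 1 }} is equal to the integer interval ⟦ j+1 − sht(j+1), j − sht(j) ⟧, each integer occurring with multiplicity one. -/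
lemma mem_farey_s8 (M : ℕ) (z : ℚ) : z ∈ fareyFinset M ↔
    ∃ r : ℕ, (1 ≤ r ∧ r ≤ M) ∧ ∃ s : ℕ, (1 ≤ s ∧ s ≤ r) ∧ (s : ℚ) / (r : ℚ) = z := by
  simp [fareyFinset]

lemma card_aux (M i : ℕ) (hi : 1 ≤ i) (hM : i ≤ M) (x y : ℚ) (hx : 0 ≤ x) (hxy : x ≤ y)
    (hy : y ≤ 1) :
    ((((fareyFinset M).filter (fun z => x < z ∧ z ≤ y)).filter (fun z => z.den ∣ i)).card : ℤ)
      = ⌊(i : ℚ) * y⌋ - ⌊(i : ℚ) * x⌋ := by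
  have hi0 : (0 : ℚ) < i := by exact_mod_cast hi
  have hle : ⌊(i : ℚ) * x⌋ ≤ ⌊(i : ℚ) * y⌋ := Int.floor_le_floor (by gcongr)
  have h1 : (Finset.Ioc ⌊(i : ℚ) * x⌋ ⌊(i : ℚ) * y⌋).card =
      (((fareyFinset M).filter (fun z => x < z ∧ z ≤ y)).filter (fun z => z.den ∣ i)).card := by
    refine Finset.card_bij (fun k _ => (k : ℚ) / i) ?_ ?_ ?_
    · intro k hk
      rw [Finset.mem_Ioc, Int.floor_lt, Int.le_floor] at hk
      obtain ⟨hk1, hk2⟩ := hk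
      have hk0 : (0 : ℚ) < k := lt_of_le_of_lt (by positivity) hk1
      have hk0' : 0 < k := by exact_mod_cast hk0
      have hki : (k : ℚ) ≤ i := by nlinarith
      have hki' : k ≤ i := by exact_mod_cast hki
      simp only [Finset.mem_filter, mem_farey_s8]
      refine ⟨⟨⟨i, ⟨hi, hM⟩, k.toNat, ⟨by omega, by omega⟩, ?_⟩, ?_, ?_⟩, ?_⟩
      · have : ((k.toNat : ℤ) : ℚ) = k := by rw [Int.toNat_of_nonneg hk0'.le]
        rw [Int.cast_natCast] at this
        rw [this]
      · rw [lt_div_iff₀ hi0]; linarith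
      · rw [div_le_iff₀ hi0]; linarith
      · have := Rat.den_dvd k i
        exact_mod_cast this
    · intro a _ b _ h
      have := (div_left_inj' hi0.ne').1 h
      exact_mod_cast this
    · intro z hz
      simp only [Finset.mem_filter] at hz
      obtain ⟨⟨_, h1, h2⟩, c, hc⟩ := hz
      have hd : (z.den : ℚ) ≠ 0 := by exact_mod_cast z.den_nz
      have hzi : ((z.num * c : ℤ) : ℚ) = i * z := by
        rw [hc]; push_cast
        have := Rat.mul_den_eq_num z
        rw [← this]; ring
      refine ⟨z.num * c, ?_, ?_⟩
      · rw [Finset.mem_Ioc, Int.floor_lt, Int.le_floor, hzi]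
        constructor <;> gcongr
      · rw [hzi]; field_simp
  rw [← h1, Int.card_Ioc]
  omega

lemma G_diff (l : ℕ) (d : Fin l → ℕ) (x y : ℚ) (hx : 0 ≤ x) (hxy : x ≤ y) (hy : y ≤ 1) :
    (∑ lam : Fin l, ∑ i ∈ Finset.Icc 1 (d lam), ⌊(i : ℚ) * y⌋)
     = (∑ lam : Fin l, ∑ i ∈ Finset.Icc 1 (d lam), ⌊(i : ℚ) * x⌋)
      + ∑ z ∈ (fareyFinset (Finset.univ.sup d)).filter (fun z => x < z ∧ z ≤ y),
          (Nr l d z.den : ℤ) := by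
  rw [← sub_eq_iff_eq_add', ← Finset.sum_sub_distrib]
  simp only [Nr, Nat.cast_sum]
  rw [Finset.sum_comm]
  refine Finset.sum_congr rfl fun lam _ => ?_
  rw [← Finset.sum_sub_distrib]
  simp only [Finset.card_filter, Nat.cast_sum]
  rw [Finset.sum_comm]
  refine Finset.sum_congr rfl fun i hi => ?_
  rw [Finset.mem_Icc] at hi
  rw [← card_aux (Finset.univ.sup d) i hi.1
    (hi.2.trans (Finset.le_sup (Finset.mem_univ lam))) x y hx hxy hy, Finset.card_filter]
  push_cast
  rfl

lemma shift_range (a : ℤ) (n : ℕ) :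
    (Multiset.range n).map (fun i : ℕ => a + (i : ℤ)) = (Finset.Ico a (a + n)).val := by
  have h : Finset.Ico a (a + n) = (Finset.range n).map
      ⟨fun i : ℕ => a + (i : ℤ), fun _ _ h => by simpa using h⟩ := by
    ext t
    simp only [Finset.mem_Ico, Finset.mem_map, Finset.mem_range]
    change _ ↔ ∃ k : ℕ, k < n ∧ a + (k : ℤ) = t
    constructor
    · intro h
      exact ⟨(t - a).toNat, by omega, by omega⟩
    · rintro ⟨k, hk, rfl⟩
      omega
  rw [h]; rfl

lemma tile (n : ℚ → ℕ) (g : ℚ → ℤ) (c b : ℤ) (S : Finset ℚ) :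
    (∀ y ∈ S, g y = c + ∑ z ∈ S.filter (fun z => z ≤ y), (n z : ℤ)) →
    ∑ y ∈ S, (Multiset.range (n y)).map (fun i : ℕ => (b - g y) + (i : ℤ)) =
      (Finset.Ico (b - (c + ∑ z ∈ S, (n z : ℤ))) (b - c)).val := by
  induction S using Finset.induction_on_max with
  | empty => intro _; simp
  | insert a S ha ih =>
    intro h
    have hna : a ∉ S := fun h' => lt_irrefl _ (ha a h')
    have hS : ∀ y ∈ S, g y = c + ∑ z ∈ S.filter (fun z => z ≤ y), (n z : ℤ) := by
      intro y hy
      rw [h y (Finset.mem_insert_of_mem hy), Finset.filter_insert, if_neg (not_le.2 (ha y hy))]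
    have hga := h a (Finset.mem_insert_self _ _)
    rw [Finset.filter_true_of_mem, Finset.sum_insert hna] at hga
    · rw [Finset.sum_insert hna, ih hS, shift_range, Finset.sum_insert hna, hga]
      have hs : 0 ≤ ∑ z ∈ S, (n z : ℤ) := Finset.sum_nonneg fun _ _ => by positivity
      generalize ∑ z ∈ S, (n z : ℤ) = s at *
      have e : b - (c + (n a + s)) + n a = b - (c + s) := by ring
      rw [e]
      rw [← Finset.Ico_union_Ico_eq_Ico (a := b - (c + (n a + s))) (b := b - (c + s)) (c := b - c)
        (by omega) (by omega), ← Finset.disjUnion_eq_union _ _ (Finset.Ico_disjoint_Ico_consecutive _ _ _)]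
      rfl
    · intro z hz
      rcases Finset.mem_insert.1 hz with rfl | hz
      · exact le_rfl
      · exact (ha z hz).le

/-- For `1 ≤ j ≤ p−1` with `F_j = F ∩ (j/p, (j+1)/p)` nonempty, the multiset
`{{ θ(y) + i : y ∈ F_j, 0 ≤ i ≤ N_{r_y} − 1 }}` equals the integer interval
`⟦j+1−sht(j+1), j−sht(j)⟧`, each integer with multiplicity one. -/
theorem middle_interval (p l : ℕ) (hp : p.Prime) (d : Fin l → ℕ)
    (hd : ∀ lam, d lam ≤ p - 1) (j : ℕ) (hj1 : 1 ≤ j) (hj2 : j ≤ p - 1)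
    (hne : ((fareyFinset (Finset.univ.sup d)).filter
        (fun y => (j : ℚ) / p < y ∧ y < ((j : ℚ) + 1) / p)).Nonempty) :
    (∑ y ∈ (fareyFinset (Finset.univ.sup d)).filter
        (fun y => (j : ℚ) / p < y ∧ y < ((j : ℚ) + 1) / p),
        (Multiset.range (Nr l d y.den)).map (fun i => theta p l d y + (i : ℤ)))
    = (Finset.Icc ((j : ℤ) + 1 - sht p l d (j + 1)) ((j : ℤ) - sht p l d j)).val := by
  have hp2 := hp.two_le
  have hp0 : (0 : ℚ) < p := by exact_mod_cast hp.pos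
  have hMp : Finset.univ.sup d ≤ p - 1 := Finset.sup_le fun lam _ => hd lam
  have hjp : j + 1 < p := by
    by_contra hcon
    have hj : j + 1 = p := by omega
    obtain ⟨y, hy⟩ := hne
    rw [Finset.mem_filter, mem_farey_s8] at hy
    obtain ⟨⟨r, hr, s, hs, rfl⟩, h1, h2⟩ := hy
    have hr0 : (0 : ℚ) < r := by exact_mod_cast hr.1
    have hjq : (j : ℚ) + 1 = p := by exact_mod_cast hj
    rw [hjq, div_self hp0.ne', div_lt_one hr0] at h2
    rw [div_lt_div_iff₀ hp0 hr0] at h1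
    have h2' : s + 1 ≤ r := by exact_mod_cast h2
    have h1' : j * r < s * p := by exact_mod_cast h1
    have hrp : r ≤ j := by omega
    subst hj
    nlinarith
  have hnot : ((j : ℚ) + 1) / p ∉ fareyFinset (Finset.univ.sup d) := by
    rw [mem_farey_s8]
    rintro ⟨r, hr, s, hs, h⟩
    have hr0 : (0 : ℚ) < r := by exact_mod_cast hr.1
    rw [div_eq_div_iff hr0.ne' hp0.ne'] at h
    have h' : s * p = (j + 1) * r := by exact_mod_cast h
    have : p ∣ (j + 1) * r := ⟨s, by rw [← h']; ring⟩
    rcases hp.dvd_mul.1 this with h | h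
    · exact absurd (Nat.le_of_dvd (by omega) h) (by omega)
    · exact absurd (Nat.le_of_dvd (by omega) h) (by omega)
  have hx0 : (0 : ℚ) ≤ (j : ℚ) / p := by positivity
  have hxy : (j : ℚ) / p ≤ ((j : ℚ) + 1) / p := by gcongr; linarith
  have hy1 : ((j : ℚ) + 1) / p < 1 := by
    rw [div_lt_one hp0]; exact_mod_cast hjp
  set S := (fareyFinset (Finset.univ.sup d)).filter
        (fun y => (j : ℚ) / p < y ∧ y < ((j : ℚ) + 1) / p) with hS
  have hshtj : sht p l d j =
      ∑ lam : Fin l, ∑ i ∈ Finset.Icc 1 (d lam), ⌊(i : ℚ) * ((j : ℚ) / p)⌋ := by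
    simp only [sht, mul_div_assoc]
  have hshtj1 : sht p l d (j + 1) = sht p l d j + ∑ z ∈ S, (Nr l d z.den : ℤ) := by
    have e : sht p l d (j + 1) =
      ∑ lam : Fin l, ∑ i ∈ Finset.Icc 1 (d lam), ⌊(i : ℚ) * (((j : ℚ) + 1) / p)⌋ := by
      simp only [sht, mul_div_assoc, Nat.cast_add, Nat.cast_one]
    rw [e, hshtj, G_diff l d _ _ hx0 hxy hy1.le]
    congr 1
    refine Finset.sum_congr ?_ fun _ _ => rfl
    refine Finset.filter_congr fun z hz => ?_
    have hzne : z ≠ ((j : ℚ) + 1) / p := fun h => hnot (h ▸ hz)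
    exact and_congr_right fun _ => ⟨fun h => lt_of_le_of_ne h hzne, le_of_lt⟩
  have key := tile (fun z => Nr l d z.den)
    (fun y => ∑ lam : Fin l, ∑ i ∈ Finset.Icc 1 (d lam), ⌊(i : ℚ) * y⌋)
    (sht p l d j) ((j : ℤ) + 1) S (by
      intro y hy
      have hy' := (Finset.mem_filter.1 hy).2
      rw [hshtj, G_diff l d _ y hx0 hy'.1.le (hy'.2.le.trans hy1.le)]
      congr 1
      refine Finset.sum_congr ?_ fun _ _ => rfl
      rw [hS, Finset.filter_filter]
      refine Finset.filter_congr fun z _ => ?_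
      constructor
      · rintro ⟨a, b⟩; exact ⟨⟨a, b.trans_lt hy'.2⟩, b⟩
      · rintro ⟨⟨a, _⟩, b⟩; exact ⟨a, b⟩)
  rw [← hshtj1] at key
  have hI : Finset.Icc ((j : ℤ) + 1 - sht p l d (j + 1)) ((j : ℤ) - sht p l d j)
      = Finset.Ico ((j : ℤ) + 1 - sht p l d (j + 1)) ((j : ℤ) + 1 - sht p l d j) := by
    ext t; simp only [Finset.mem_Icc, Finset.mem_Ico]; omega
  rw [hI, ← key]
  refine Finset.sum_congr rfl fun y hy => ?_
  have hy' := (Finset.mem_filter.1 hy).2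
  have f0 : ⌊y⌋ = 0 := by
    rw [Int.floor_eq_zero_iff]
    exact ⟨hx0.trans hy'.1.le, hy'.2.trans hy1⟩
  have f1 : ⌊(p : ℚ) * y⌋ = j := by
    rw [Int.floor_eq_iff]
    have a := (div_lt_iff₀ hp0).1 hy'.1
    have b := (lt_div_iff₀ hp0).1 hy'.2
    constructor
    · push_cast; linarith
    · push_cast; linarith
  have ht : theta p l d y = (j : ℤ) + 1 -
      ∑ lam : Fin l, ∑ i ∈ Finset.Icc 1 (d lam), ⌊(i : ℚ) * y⌋ := by
    rw [theta, f0, f1]; ring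
  rw [ht]
  simp only [Multiset.bind_def, Multiset.pure_def, Multiset.bind_singleton, Multiset.map_map,
    Function.comp_def]
end

section
/- Let N ≥ 0 and let A_0, …, A_N and B_0, …, B_N be integers; set A_{N+1} := A_0. Suppose that B_m ≤ min(A_m, A_{m+1}) for every 0 ≤ m ≤ N. Then the two multisets of integers ⊎_{m=0}^{N} ⟦B_m, A_m⟧ and ⊎_{m=0}^{N} ⟦B_m, A_{m+1}⟧ are equal. -/
/-- Lemma A.7 (union of intervals): given integers `A_0,…,A_N` and `B_0,…,B_N`
with `A_{N+1} := A_0` and `B_m ≤ min(A_m, A_{m+1})` for all `0 ≤ m ≤ N`, the multisets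
`⊎_{m=0}^{N} ⟦B_m, A_m⟧` and `⊎_{m=0}^{N} ⟦B_m, A_{m+1}⟧` coincide. -/
theorem union_intervals (N : ℕ) (A B : ℕ → ℤ) (hA : A (N + 1) = A 0)
    (hB : ∀ m ≤ N, B m ≤ min (A m) (A (m + 1))) :
    (∑ m ∈ Finset.range (N + 1), (Finset.Icc (B m) (A m)).val)
      = ∑ m ∈ Finset.range (N + 1), (Finset.Icc (B m) (A (m + 1))).val := by
  ext x
  rw [Multiset.count_sum', Multiset.count_sum']
  have key : ∀ b a : ℤ, b ≤ a → Multiset.count x (Finset.Icc b a).val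
      + (if a < x then 1 else 0) = if b ≤ x then 1 else 0 := by
    intro b a h
    rw [Multiset.count_eq_of_nodup (Finset.Icc b a).nodup]
    simp only [Finset.mem_val, Finset.mem_Icc]
    split_ifs <;> omega
  have h1 : ∑ m ∈ Finset.range (N + 1), (Multiset.count x (Finset.Icc (B m) (A m)).val
      + (if A m < x then 1 else 0)) = ∑ m ∈ Finset.range (N + 1),
      (Multiset.count x (Finset.Icc (B m) (A (m + 1))).val
      + (if A (m + 1) < x then 1 else 0)) := by
    refine Finset.sum_congr rfl fun m hm => ?_
    have h := le_min_iff.1 (hB m (by simpa [Nat.lt_succ_iff] using hm))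
    rw [key _ _ h.1, key _ _ h.2]
  have h2 : ∑ m ∈ Finset.range (N + 1), (if A m < x then 1 else 0)
      = ∑ m ∈ Finset.range (N + 1), (if A (m + 1) < x then 1 else 0) := by
    rw [Finset.sum_range_succ', Finset.sum_range_succ, hA]
  rw [Finset.sum_add_distrib, Finset.sum_add_distrib, h2] at h1
  exact Nat.add_right_cancel h1
end

section
/- Let k be a commutative ring in which p·1 = 0 for a prime p, let d = (d_1,…,d_l) be a sequence of integers with 0 ≤ d_λ ≤ p−1, and let R be the polynomial ring over k in the variables x_{(λ,i)} for 1 ≤ λ ≤ l and 0 ≤ i ≤ d_λ. Let ∂ be the unique k-derivation of R with ∂(x_{(λ,i)}) = x_{(λ,i+1)} for 0 ≤ i ≤ d_λ − 1 and ∂(x_{(λ,d_λ)}) = 0. Then the p-fold composite of ∂ with itself, as a k-linear endomorphism of R, is the zero map. -/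
open MvPolynomial

theorem aux_iterate_mul {k A : Type*} [CommRing k] [CommRing A] [Algebra k A]
    (D : Derivation k A A) (n : ℕ) (a b : A) :
    (⇑D)^[n] (a * b) = ∑ ij ∈ Finset.HasAntidiagonal.antidiagonal n,
      n.choose ij.1 • ((⇑D)^[ij.1] a * (⇑D)^[ij.2] b) := by
  induction n with
  | zero => simp
  | succ n ih =>
    rw [Finset.sum_antidiagonal_choose_succ_nsmul
      (fun i j => (⇑D)^[i] a * (⇑D)^[j] b), Function.iterate_succ_apply', ih, map_sum,
      ← Finset.sum_add_distrib]
    refine Finset.sum_congr rfl fun ij hij => ?_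
    have h : n.choose ij.2 = n.choose ij.1 := by
      rw [Finset.HasAntidiagonal.mem_antidiagonal] at hij
      exact Nat.choose_symm_of_eq_add (by omega)
    rw [map_nsmul, Derivation.leibniz, h, Function.iterate_succ_apply',
      Function.iterate_succ_apply', smul_eq_mul, smul_eq_mul, ← nsmul_add]
    congr 2
    exact mul_comm _ _

/-- Let `k` be a commutative ring with `p·1 = 0` for a prime `p`, and let `R` be the
polynomial ring over `k` on the variables `x_{(λ,i)}`, `1 ≤ λ ≤ l`, `0 ≤ i ≤ d_λ`.
If `∂` is the `k`-derivation of `R` with `∂(x_{(λ,i)}) = x_{(λ,i+1)}` for `i < d_λ`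
and `∂(x_{(λ,d_λ)}) = 0`, then the `p`-fold composite of `∂` with itself is the zero map. -/
theorem derivation_pow_p_eq_zero (k : Type*) [CommRing k] (p : ℕ) (hp : p.Prime)
    (hpk : (p : k) = 0) (l : ℕ) (d : Fin l → ℕ) (hd : ∀ lam, d lam ≤ p - 1)
    (D : Derivation k (MvPolynomial ((lam : Fin l) × Fin (d lam + 1)) k)
      (MvPolynomial ((lam : Fin l) × Fin (d lam + 1)) k))
    (hD : ∀ (lam : Fin l) (i : Fin (d lam + 1)),
      D (X ⟨lam, i⟩) =
        if h : (i : ℕ) < d lam then X ⟨lam, ⟨(i : ℕ) + 1, by omega⟩⟩ else 0) :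
    ∀ f : MvPolynomial ((lam : Fin l) × Fin (d lam + 1)) k, (⇑D)^[p] f = 0 := by
  have h0 : ∀ n, (⇑D)^[n] 0 = 0 := fun n => Function.iterate_fixed (map_zero D) n
  have hp0 := hp.pos
  have hX : ∀ (m : ℕ) (lam : Fin l) (i : Fin (d lam + 1)), d lam < i + m →
      (⇑D)^[m] (X ⟨lam, i⟩) = 0 := by
    intro m
    induction m with
    | zero => intro lam i h; have := i.isLt; omega
    | succ m ih =>
      intro lam i h
      rw [Function.iterate_succ_apply, hD]
      split_ifs with h1
      · exact ih _ _ (by simp only; omega)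
      · exact h0 m
  have hpR : (p : MvPolynomial ((lam : Fin l) × Fin (d lam + 1)) k) = 0 := by
    rw [← map_natCast (C : k →+* _), hpk, map_zero]
  intro f
  induction f using MvPolynomial.induction_on with
  | C a =>
    obtain ⟨q, rfl⟩ : ∃ q, p = q + 1 := ⟨p - 1, by omega⟩
    rw [Function.iterate_succ_apply, MvPolynomial.derivation_C, h0]
  | add f g hf hg =>
    rw [iterate_map_add, hf, hg, add_zero]
  | mul_X f s hf =>
    rw [aux_iterate_mul]
    refine Finset.sum_eq_zero fun ij hij => ?_
    rw [Finset.HasAntidiagonal.mem_antidiagonal] at hij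
    by_cases h1 : ij.1 = 0
    · have h2 : ij.2 = p := by omega
      obtain ⟨lam, i⟩ := s
      have := hd lam
      rw [h2, hX p lam i (by omega), mul_zero, smul_zero]
    · by_cases h2 : ij.1 = p
      · rw [h2, hf, zero_mul, smul_zero]
      · obtain ⟨c, hc⟩ := hp.dvd_choose_self h1 (by omega)
        rw [hc, nsmul_eq_mul, Nat.cast_mul, hpR, zero_mul, zero_mul]
end
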